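/- arXiv:2212.10689 — 6 statements merged into one kernel-verified Lean document; each statement's English description precedes it below -/
import Mathlib

section
/- Let p be an odd prime and let r be a positive integer. Consider the polynomial H_r(T) = 1 - (-1)^r (1+T)^r in ℤ[T]. If r is odd, then the least index i such that p does not divide the coefficient of T^i in H_r is 0 (indeed the constant coefficient equals 2). If r is even, then the least index i such that p does not divide the coefficient of T^i in H_r equals p^{v_p(r)}, where v_p(r) denotes the p-adic valuation of r. -/
/-- `H r = 1 - (-1)^r (1+T)^r` as an integer polynomial. -/
noncomputable def Hpoly (r : ℕ) : Polynomial ℤ :=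
  1 - (-1) ^ r * (1 + Polynomial.X) ^ r

theorem choose_aux (p : ℕ) [Fact p.Prime] (v m i : ℕ) :
    ((Nat.choose (p ^ v * m) i : ℕ) : ZMod p) =
      if p ^ v ∣ i then ((Nat.choose m (i / p ^ v) : ℕ) : ZMod p) else 0 := by
  have hq : 0 < p ^ v := pow_pos (Fact.out : p.Prime).pos _
  have h : ((1 + Polynomial.X : Polynomial (ZMod p))) ^ (p ^ v * m) =
      Polynomial.expand (ZMod p) (p ^ v) ((1 + Polynomial.X) ^ m) := by
    rw [pow_mul, add_pow_char_pow]
    simp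
  have h2 := congrArg (fun f => Polynomial.coeff f i) h
  simp only [Polynomial.coeff_expand hq, Polynomial.coeff_one_add_X_pow] at h2
  exact h2

theorem Hcoeff_even (r : ℕ) (hr : Even r) (i : ℕ) :
    (Hpoly r).coeff i = (if i = 0 then 1 else 0) - (Nat.choose r i : ℤ) := by
  simp [Hpoly, hr.neg_one_pow, Polynomial.coeff_one_add_X_pow, Polynomial.coeff_one]

theorem stmt0 (p : ℕ) (hp : p.Prime) (hpodd : Odd p) (r : ℕ) (hr : 0 < r) :
    (Odd r →
      sInf {i : ℕ | ¬ (p : ℤ) ∣ (Hpoly r).coeff i} = 0 ∧ (Hpoly r).coeff 0 = 2) ∧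
    (Even r →
      sInf {i : ℕ | ¬ (p : ℤ) ∣ (Hpoly r).coeff i} = p ^ padicValNat p r) := by
  haveI : Fact p.Prime := ⟨hp⟩
  constructor
  · intro ho
    have h0 : (Hpoly r).coeff 0 = 2 := by
      simp [Hpoly, ho.neg_one_pow, Polynomial.coeff_one_add_X_pow]
      try norm_num
    refine ⟨?_, h0⟩
    rw [Nat.sInf_eq_zero]
    left
    show ¬ (p : ℤ) ∣ (Hpoly r).coeff 0
    rw [h0]
    intro h
    have h' : p ∣ 2 := by exact_mod_cast h
    have := (Nat.prime_dvd_prime_iff_eq hp Nat.prime_two).1 h'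
    subst this
    exact absurd hpodd (by decide)
  · intro he
    obtain ⟨m, hm⟩ := pow_padicValNat_dvd (p := p) (n := r)
    have hpm : ¬ p ∣ m := by
      intro hd
      apply pow_succ_padicValNat_not_dvd (p := p) hr.ne'
      obtain ⟨k, rfl⟩ := hd
      exact ⟨k, by rw [pow_succ, mul_assoc]; exact hm⟩
    generalize padicValNat p r = v at hm ⊢
    have hq : 0 < p ^ v := pow_pos hp.pos _
    apply IsLeast.csInf_eq
    constructor
    · show ¬ (p : ℤ) ∣ (Hpoly r).coeff (p ^ v)
      rw [Hcoeff_even r he, if_neg hq.ne', ← ZMod.intCast_zmod_eq_zero_iff_dvd, hm]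
      push_cast
      rw [choose_aux]
      simpa [Nat.div_self hq, ZMod.natCast_eq_zero_iff] using hpm
    · intro i hi
      by_contra hlt
      push Not at hlt
      apply hi
      rw [Hcoeff_even r he]
      rcases Nat.eq_zero_or_pos i with rfl | hi0
      · simp
      · rw [if_neg hi0.ne', ← ZMod.intCast_zmod_eq_zero_iff_dvd, hm]
        push_cast
        rw [choose_aux, if_neg (Nat.not_dvd_of_pos_of_lt hi0 hlt)]
        simp
end

section
/- Let p be an odd prime, n ≥ 2 an integer, and k = (k_1, …, k_{n-1}) a tuple of positive integers such that p does not divide k_i for every index i with k_i even. Set e(k) := #{i : k_i is even} and G_k(T) := ∏_{i=1}^{n-1} (1 - (-1)^{k_i} (1+T)^{k_i}) ∈ ℤ[T]. Then the least index j such that p does not divide the coefficient of T^j in G_k equals e(k). -/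
/-- `G_k(T) = ∏ (1 - (-1)^(k i) (1+T)^(k i))` as an integer polynomial. -/
noncomputable def Gpoly (n : ℕ) (k : Fin (n - 1) → ℕ) : Polynomial ℤ :=
  ∏ i : Fin (n - 1), (1 - (-1) ^ k i * (1 + Polynomial.X) ^ k i)

open Polynomial in
lemma factor_aux (p : ℕ) (hp : p.Prime) (hpodd : Odd p) (k : ℕ)
    (hdiv : Even k → ¬ (p ∣ k)) :
    ∃ q : Polynomial ℤ, (1 - (-1) ^ k * (1 + X) ^ k : Polynomial ℤ)
      = X ^ (if Even k then 1 else 0) * q ∧ ¬ (p : ℤ) ∣ q.coeff 0 := by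
  by_cases h : Even k
  · have h0 : (1 - (1 + X) ^ k : Polynomial ℤ).coeff 0 = 0 := by
      rw [coeff_sub, coeff_one_add_X_pow]; simp
    have h1 : (1 - (1 + X) ^ k : Polynomial ℤ).coeff 1 = -k := by
      rw [coeff_sub, coeff_one_add_X_pow]; simp [coeff_one]
    obtain ⟨q, hq⟩ := X_dvd_iff.2 h0
    refine ⟨q, by simpa [h, h.neg_one_pow] using hq, ?_⟩
    rw [hq, mul_comm, coeff_mul_X] at h1
    rw [h1, dvd_neg, Int.natCast_dvd_natCast]
    exact hdiv h
  · have ho : Odd k := Nat.not_even_iff_odd.1 h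
    refine ⟨1 + (1 + X) ^ k, by simp [h, ho.neg_one_pow], ?_⟩
    have : (1 + (1 + X) ^ k : Polynomial ℤ).coeff 0 = (2 : ℕ) := by
      rw [coeff_add, coeff_one_add_X_pow]; simp
    rw [this, Int.natCast_dvd_natCast, Nat.prime_dvd_prime_iff_eq hp Nat.prime_two]
    rintro rfl
    exact absurd hpodd (by decide)

theorem stmt5 (p : ℕ) (hp : p.Prime) (hpodd : Odd p) (n : ℕ) (hn : 2 ≤ n)
    (k : Fin (n - 1) → ℕ) (hk : ∀ i, 1 ≤ k i)
    (hdiv : ∀ i, Even (k i) → ¬ (p ∣ k i)) :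
    sInf {j : ℕ | ¬ (p : ℤ) ∣ (Gpoly n k).coeff j} =
      (Finset.univ.filter fun i => Even (k i)).card := by
  choose q hq hq0 using fun i => factor_aux p hp hpodd (k i) (hdiv i)
  have hG : Gpoly n k = Polynomial.X ^ (Finset.univ.filter fun i => Even (k i)).card
      * ∏ i, q i := by
    unfold Gpoly
    rw [Finset.prod_congr rfl (fun i _ => hq i), Finset.prod_mul_distrib,
      Finset.prod_pow_eq_pow_sum, Finset.card_filter]
  have hpi : Prime (p : ℤ) := Nat.prime_iff_prime_int.1 hp
  have hmem : ¬ (p : ℤ) ∣ (Gpoly n k).coeff (Finset.univ.filter fun i => Even (k i)).card := by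
    rw [hG, Polynomial.coeff_X_pow_mul', if_pos le_rfl, Nat.sub_self,
      Polynomial.coeff_zero_prod, hpi.dvd_finset_prod_iff]
    rintro ⟨i, _, hi⟩
    exact hq0 i hi
  apply le_antisymm
  · exact Nat.sInf_le hmem
  · refine le_csInf ⟨_, hmem⟩ ?_
    intro j hj
    by_contra hlt
    apply hj
    rw [hG, Polynomial.coeff_X_pow_mul', if_neg hlt]
    exact dvd_zero _
end

section
/- Let n ≥ 2 be an integer. For 1 ≤ i ≤ n-1, let V_i be the (n-1)×(n-1) matrix over the polynomial ring ℤ[t] that agrees with the identity matrix except in the following entries: (V_i)_{i,i} = -t; (V_i)_{i-1,i} = t when i ≥ 2; and (V_i)_{i+1,i} = 1 when i ≤ n-2 (for n = 2, V_1 is the 1×1 matrix (-t)). Then for every tuple k = (k_1, …, k_{n-1}) of non-negative integers, the following identity holds in ℤ[t]: det(I_{n-1} - V_1^{k_1} V_2^{k_2} ⋯ V_{n-1}^{k_{n-1}}) · (1-t) · (1+t)^{n-1} = (1 - t^n) · ∏_{i=1}^{n-1} (1 - (-1)^{k_i} t^{k_i}). -/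
/-- The image `V_i = ψ̄_n(σ_i)` of the `i`-th braid generator (here indexed from `0`,
so `i : Fin (n-1)` corresponds to the 1-based generator `σ_{i+1}`) under the reduced
Burau representation: it agrees with the identity matrix except that the `(i,i)` entry
is `-t`, the `(i-1,i)` entry is `t` (when it exists), and the `(i+1,i)` entry is `1`
(when it exists). -/
noncomputable def burauV (n : ℕ) (i : Fin (n - 1)) :
    Matrix (Fin (n - 1)) (Fin (n - 1)) (Polynomial ℤ) :=
  Matrix.of fun a b =>
    if a = b then (if a = i then -Polynomial.X else 1)
    else if b = i ∧ (a : ℕ) + 1 = (i : ℕ) then Polynomial.X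
    else if b = i ∧ (a : ℕ) = (i : ℕ) + 1 then 1
    else 0

open Polynomial in
/-- the tridiagonal matrix -/
noncomputable def triM (m : ℕ) : Matrix (Fin m) (Fin m) (Polynomial ℤ) :=
  Matrix.of fun a b =>
    if a = b then -(1 + X)
    else if (a : ℕ) + 1 = (b : ℕ) then X
    else if (a : ℕ) = (b : ℕ) + 1 then 1
    else 0

open Polynomial in
theorem triM_det_rec (m : ℕ) :
    (-triM (m+2)).det = (1 + X) * (-triM (m+1)).det - X * (-triM m).det := by
  rw [Matrix.det_succ_row_zero, Fin.sum_univ_succ, Fin.sum_univ_succ, Finset.sum_eq_zero]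
  · have h1 : (-triM (m+2)).submatrix Fin.succ (Fin.succAbove 0) = -triM (m+1) := by
      ext1 a b
      simp [triM]
    have h2 : ((-triM (m+2)).submatrix Fin.succ (Fin.succAbove (Fin.succ 0))).det
        = - (-triM m).det := by
      rw [Matrix.det_succ_column_zero, Fin.sum_univ_succ, Finset.sum_eq_zero]
      · have h3 : (((-triM (m+2)).submatrix Fin.succ (Fin.succAbove (Fin.succ 0))).submatrix
          (Fin.succAbove 0) Fin.succ) = -triM m := by
          ext1 a b
          have : Fin.succAbove (Fin.succ (0 : Fin (m+1))) (Fin.succ b) = b.succ.succ := by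
            rw [Fin.succ_succAbove_succ]; simp
          simp [triM, -Fin.succ_zero_eq_one, this]
        rw [h3]
        simp [triM]
      · intro i _
        simp [triM]
    rw [h1, h2]
    simp [triM]
    ring
  · intro i _
    have : (0 : Fin (m+2)) ≠ i.succ.succ := (Fin.succ_ne_zero _).symm
    simp [triM, this]

open Polynomial in
theorem triM_det (m : ℕ) : (-triM m).det * (1 - X) = 1 - X ^ (m+1) := by
  induction m using Nat.twoStepInduction with
  | zero => simp
  | one => simp [triM]; ring
  | more m h1 h2 =>
    rw [triM_det_rec]
    linear_combination (1 + X) * h2 - X * h1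

open Polynomial in
theorem key (m : ℕ) (M : Matrix (Fin m) (Fin m) ℤ[X]) (c : Fin m → ℤ[X])
    (W : Fin m → Matrix (Fin m) (Fin m) ℤ[X])
    (hW : ∀ i, W i = 1 + c i • (M * Matrix.single i i 1)) :
    (1 - (List.ofFn W).prod).det = (-M).det * ∏ i, c i := by
  let A : Matrix (Fin m) (Fin m) ℤ[X] :=
    1 - Matrix.of fun a b => if a < b then M a b * c b else 0
  have hA : A.det = 1 := by
    rw [Matrix.det_of_isUpperTriangular]
    · simp [A]
    · intro a b hab
      have hab' : b < a := hab
      simp [A, hab'.ne', hab'.not_gt]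
  let F : ℕ → Matrix (Fin m) (Fin m) ℤ[X] :=
    fun r => Matrix.of fun a b => if r ≤ (b : ℕ) then M a b * c b else 0
  have step : ∀ d r, r + d = m → ((List.ofFn W).drop r).prod * A = A + F r := by
    intro d
    induction d with
    | zero =>
      intro r hr
      rw [List.drop_eq_nil_of_le (by simp; omega)]
      have : F r = 0 := by
        ext1 a b
        have := b.2
        simp [F]; intro; omega
      simp [this]
    | succ d ih =>
      intro r hr
      have hrm : r < m := by omega
      rw [List.drop_eq_getElem_cons (by simpa using hrm), List.prod_cons, Matrix.mul_assoc,
        ih (r+1) (by omega), List.getElem_ofFn, hW]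
      have hE : Matrix.single (⟨r, hrm⟩ : Fin m) ⟨r, hrm⟩ (1 : ℤ[X]) * (A + F (r+1))
          = Matrix.single ⟨r, hrm⟩ ⟨r, hrm⟩ 1 := by
        ext1 a b
        by_cases ha : a = ⟨r, hrm⟩
        · subst ha
          rw [Matrix.single_mul_apply_same]
          simp [A, F, Matrix.single_apply, Matrix.one_apply, Fin.lt_iff_val_lt_val, Nat.succ_le_iff, -Fin.val_fin_lt]
        · rw [Matrix.single_mul_apply_of_ne _ _ _ _ _ ha]
          rw [Matrix.single_apply, if_neg]
          rintro ⟨h, _⟩; exact ha h.symm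
      rw [Matrix.add_mul, Matrix.smul_mul, Matrix.mul_assoc, hE, Matrix.one_mul, add_assoc]
      congr 1
      ext1 a b
      by_cases hb : b = ⟨r, hrm⟩
      · subst hb
        simp [F, mul_comm]
      · have hb' : (b : ℕ) ≠ r := fun h => hb (Fin.ext h)
        have : (r + 1 ≤ (b : ℕ)) ↔ r ≤ (b : ℕ) := by omega
        simp only [Matrix.add_apply, Matrix.smul_apply, F, Matrix.of_apply, this]
        rw [Matrix.mul_single_apply_of_ne _ _ _ _ _ hb]
        simp
  have h0 := step m 0 (by simp)
  rw [List.drop_zero] at h0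
  have hF : F 0 = M * Matrix.diagonal c := by
    ext1 a b
    simp [F]
  have h1 : (1 - (List.ofFn W).prod) * A = (-M) * Matrix.diagonal c := by
    rw [Matrix.sub_mul, h0, hF]; simp
  have := congrArg Matrix.det h1
  rw [Matrix.det_mul, Matrix.det_mul, hA, Matrix.det_diagonal, mul_one] at this
  exact this

open Polynomial in
theorem burau_pow (m : ℕ) (i : Fin m) (k : ℕ) :
    (burauV (m+1) i ^ k : Matrix (Fin m) (Fin m) ℤ[X])
      = 1 + (∑ j ∈ Finset.range k, (-X : ℤ[X]) ^ j) • (triM m * Matrix.single i i 1) := by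
  have hV : (burauV (m+1) i : Matrix (Fin m) (Fin m) ℤ[X])
      = 1 + triM m * Matrix.single i i 1 := by
    ext1 a b
    by_cases hb : b = i
    · subst hb
      rw [Matrix.add_apply, Matrix.mul_single_apply_same]
      simp only [burauV, triM, Matrix.of_apply, Matrix.one_apply]
      by_cases hab : a = b
      · simp [hab]
      · simp [hab]
    · rw [Matrix.add_apply, Matrix.mul_single_apply_of_ne _ _ _ _ _ hb]
      simp only [burauV, Matrix.of_apply, Matrix.one_apply]
      by_cases hab : a = b
      · subst hab; simp [hb]
      · simp [hab, hb]
  have hE : (Matrix.single i i 1 : Matrix (Fin m) (Fin m) ℤ[X]) *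
      (triM m * Matrix.single i i 1) = (-(1 + X) : ℤ[X]) • Matrix.single i i 1 := by
    rw [← Matrix.mul_assoc, Matrix.single_mul_mul_single]
    simp [triM]
  induction k with
  | zero => simp
  | succ k ih =>
    have : (burauV (m+1) i ^ (k+1) : Matrix (Fin m) (Fin m) ℤ[X])
      = (burauV (m+1) i ^ k : Matrix (Fin m) (Fin m) ℤ[X]) * burauV (m+1) i := pow_succ _ _
    rw [this, ih, hV, Matrix.add_mul, Matrix.one_mul, Matrix.mul_add, Matrix.mul_one,
      Matrix.smul_mul, Matrix.mul_assoc, hE, Matrix.mul_smul, geom_sum_succ, smul_smul, add_assoc,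
      ← add_smul]
    nth_rewrite 1 [← one_smul ℤ[X] (triM m * Matrix.single i i 1)]
    rw [← add_smul]
    congr 2
    ring

theorem stmt7 (n : ℕ) (hn : 2 ≤ n) (k : Fin (n - 1) → ℕ) :
    Matrix.det (1 - (List.ofFn fun i : Fin (n - 1) => burauV n i ^ k i).prod) *
        (1 - Polynomial.X) * (1 + Polynomial.X) ^ (n - 1) =
      (1 - Polynomial.X ^ n) *
        ∏ i : Fin (n - 1), (1 - (-1) ^ k i * Polynomial.X ^ k i) := by
  obtain ⟨m, rfl⟩ : ∃ m, n = m + 1 := ⟨n - 1, by omega⟩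
  change Fin m → ℕ at k
  have h := key m (triM m) (fun i => ∑ j ∈ Finset.range (k i), (-Polynomial.X) ^ j)
    (fun i => burauV (m+1) i ^ k i) (fun i => burau_pow m i (k i))
  have h2 : (∏ i : Fin m, (∑ j ∈ Finset.range (k i), (-Polynomial.X : Polynomial ℤ) ^ j)) *
      (1 + Polynomial.X) ^ m =
      ∏ i : Fin m, (1 - (-1) ^ k i * Polynomial.X ^ k i) := by
    have : (1 + Polynomial.X : Polynomial ℤ) ^ m = ∏ _i : Fin m, (1 + Polynomial.X) := by simp
    rw [this, ← Finset.prod_mul_distrib]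
    refine Finset.prod_congr rfl fun i _ => ?_
    have := geom_sum_mul_neg (-Polynomial.X : Polynomial ℤ) (k i)
    rw [sub_neg_eq_add] at this
    rw [this, neg_pow]
  change Matrix.det (1 - (List.ofFn fun i : Fin m => burauV (m+1) i ^ k i).prod) *
        (1 - Polynomial.X) * (1 + Polynomial.X) ^ m =
      (1 - Polynomial.X ^ (m+1)) *
        ∏ i : Fin m, (1 - (-1) ^ k i * Polynomial.X ^ k i)
  rw [← h2, ← triM_det]
  refine (congrArg (fun z => z * (1 - Polynomial.X) * (1 + Polynomial.X) ^ m) h).trans ?_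
  ring
end

section
/- Let n ≥ 2 be an integer. For 1 ≤ i ≤ n-1, let U_i be the n×n matrix over the polynomial ring ℤ[t] that agrees with the identity matrix except in its 2×2 block in rows and columns i, i+1, where it equals the block matrix with entries (1-t, t; 1, 0). Then the map from ℤ_{≥0}^{n-1} to n×n matrices over ℤ[t] sending (k_1, …, k_{n-1}) to the product U_1^{k_1} U_2^{k_2} ⋯ U_{n-1}^{k_{n-1}} is injective: if U_1^{k_1} ⋯ U_{n-1}^{k_{n-1}} = U_1^{k_1'} ⋯ U_{n-1}^{k_{n-1}'} for tuples k, k' of non-negative integers, then k = k'. -/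
/-- The image `U_i = ψ_n(σ_i)` of the `i`-th braid generator (here indexed from `0`,
so `i : Fin (n-1)` corresponds to the 1-based generator `σ_{i+1}`) under the unreduced
Burau representation: it agrees with the identity matrix except in the `2×2` block in
rows and columns `i, i+1`, where it equals `(1-t, t; 1, 0)`. -/
noncomputable def burauU (n : ℕ) (i : Fin (n - 1)) :
    Matrix (Fin n) (Fin n) (Polynomial ℤ) :=
  Matrix.of fun a b =>
    if (a : ℕ) = (i : ℕ) ∧ (b : ℕ) = (i : ℕ) then 1 - Polynomial.X
    else if (a : ℕ) = (i : ℕ) ∧ (b : ℕ) = (i : ℕ) + 1 then Polynomial.X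
    else if (a : ℕ) = (i : ℕ) + 1 ∧ (b : ℕ) = (i : ℕ) then 1
    else if (a : ℕ) = (i : ℕ) + 1 ∧ (b : ℕ) = (i : ℕ) + 1 then 0
    else if a = b then 1 else 0

def bc (n : ℕ) (i : Fin (n - 1)) : Fin n := ⟨i, by omega⟩
def bd (n : ℕ) (i : Fin (n - 1)) : Fin n := ⟨i + 1, by omega⟩

def bu (n : ℕ) (i : Fin (n - 1)) : Fin n → ℤ := Pi.single (bc n i) 1 + Pi.single (bd n i) 1
def bv (n : ℕ) (i : Fin (n - 1)) : Fin n → ℤ := Pi.single (bc n i) 1 - Pi.single (bd n i) 1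
def bN (n : ℕ) (i : Fin (n - 1)) : Matrix (Fin n) (Fin n) ℤ := Matrix.vecMulVec (bu n i) (bv n i)

lemma bcd (n : ℕ) (i : Fin (n - 1)) : bc n i ≠ bd n i := by
  simp [bc, bd, Fin.ext_iff]

lemma bN_sq (n : ℕ) (i : Fin (n - 1)) : bN n i * bN n i = 0 := by
  have : bv n i ⬝ᵥ bu n i = 0 := by
    simp [bu, bv, dotProduct_add, bcd, (bcd n i).symm]
  unfold bN
  rw [Matrix.vecMulVec_mul_vecMulVec, this]
  simp

noncomputable abbrev bev (n : ℕ) :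
    Matrix (Fin n) (Fin n) (Polynomial ℤ) →+* Matrix (Fin n) (Fin n) ℤ :=
  (Polynomial.evalRingHom (-1 : ℤ)).mapMatrix

lemma bev_U (n : ℕ) (i : Fin (n - 1)) : bev n (burauU n i) = 1 + bN n i := by
  ext a b
  simp only [bev, burauU, bN, bu, bv, RingHom.mapMatrix_apply, Matrix.map_apply, Matrix.of_apply,
    Matrix.add_apply, Matrix.vecMulVec_apply, Pi.add_apply, Pi.sub_apply, Pi.single_apply,
    Matrix.one_apply, bc, bd, Fin.ext_iff]
  split_ifs <;> first | omega | simp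

lemma bpow (n : ℕ) (i : Fin (n - 1)) (k : ℕ) : (1 + bN n i) ^ k = 1 + (k : ℤ) • bN n i := by
  induction k with
  | zero => simp
  | succ k ih =>
    rw [pow_succ, ih, add_mul, mul_add, mul_add, smul_mul_assoc, smul_mul_assoc, bN_sq]
    simp [add_smul]
    abel

lemma bcancel (n : ℕ) (i : Fin (n - 1)) (k : ℕ) (A B : Matrix (Fin n) (Fin n) ℤ)
    (h : (1 + bN n i) ^ k * A = (1 + bN n i) ^ k * B) : A = B := by
  have hl : (1 - (k : ℤ) • bN n i) * (1 + bN n i) ^ k = 1 := by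
    rw [bpow, sub_mul, one_mul, mul_add, mul_one, smul_mul_assoc, mul_smul_comm, bN_sq]
    simp only [one_mul, mul_one, smul_zero, add_zero]
    abel
  have := congrArg ((1 - (k : ℤ) • bN n i) * ·) h
  simpa only [← mul_assoc, hl, one_mul] using this

lemma bfix (n : ℕ) (k : Fin (n - 1) → ℕ) (i : Fin (n - 1)) (l : List (Fin (n - 1)))
    (hl : ∀ j ∈ l, i < j) :
    (l.map fun j => (1 + bN n j) ^ k j).prod.mulVec (Pi.single (bc n i) 1)
      = Pi.single (bc n i) 1 := by
  induction l with
  | nil => rw [List.map_nil, List.prod_nil, Matrix.one_mulVec]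
  | cons j l ih =>
    have hj : i < j := hl j (by simp)
    have h0 : bv n j (bc n i) = 0 := by
      have : (i : ℕ) < j := hj
      simp only [bv, bc, bd, Pi.sub_apply, Pi.single_apply, Fin.ext_iff]
      split_ifs <;> first | omega | simp
    rw [List.map_cons, List.prod_cons, ← Matrix.mulVec_mulVec,
      ih (fun a ha => hl a (by simp [ha])), bpow, Matrix.add_mulVec, Matrix.smul_mulVec,
      Matrix.one_mulVec]
    ext a
    simp [bN, Matrix.vecMulVec_apply, h0]

lemma bmain (n : ℕ) (k k' : Fin (n - 1) → ℕ) (l : List (Fin (n - 1)))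
    (hl : l.Pairwise (· < ·))
    (h : (l.map fun j => (1 + bN n j) ^ k j).prod = (l.map fun j => (1 + bN n j) ^ k' j).prod) :
    ∀ i ∈ l, k i = k' i := by
  induction l with
  | nil => simp
  | cons i l ih =>
    rw [List.pairwise_cons] at hl
    simp only [List.map_cons, List.prod_cons] at h
    have hi : k i = k' i := by
      have := congrFun (congrArg (fun M => M.mulVec (Pi.single (bc n i) 1)) h) (bc n i)
      simp only [← Matrix.mulVec_mulVec] at this
      rw [bfix n k i l hl.1, bfix n k' i l hl.1, bpow, bpow, Matrix.add_mulVec, Matrix.smul_mulVec,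
        Matrix.add_mulVec, Matrix.smul_mulVec] at this
      simpa [bN, bu, bv, Matrix.vecMulVec_apply, bcd] using this
    rw [hi] at h
    have := ih hl.2 (bcancel _ _ _ _ _ h)
    simpa [hi] using this

theorem stmt8 (n : ℕ) (hn : 2 ≤ n) (k k' : Fin (n - 1) → ℕ)
    (h : (List.ofFn fun i : Fin (n - 1) => burauU n i ^ k i).prod =
      (List.ofFn fun i : Fin (n - 1) => burauU n i ^ k' i).prod) :
    k = k' := by
  have h2 := congrArg (bev n) h
  rw [map_list_prod, map_list_prod, List.ofFn_eq_map, List.ofFn_eq_map, List.map_map,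
    List.map_map] at h2
  have e : ∀ k : Fin (n - 1) → ℕ, (⇑(bev n) ∘ fun i => burauU n i ^ k i)
      = fun j => (1 + bN n j) ^ k j := by
    intro k
    funext j
    simp only [Function.comp_apply, map_pow, bev_U]
  rw [e, e] at h2
  funext i
  exact bmain n k k' _ (List.pairwise_lt_finRange _) h2 i (List.mem_finRange i)
end

section
/- Let M be the 2×2 matrix over the polynomial ring ℤ[t] with entries M = (1-t, t; 1, 0). Then for every non-negative integer a, the (1,1) entry of M^a is a polynomial in t of degree exactly a. -/
theorem stmt9 (M : Matrix (Fin 2) (Fin 2) (Polynomial ℤ))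
    (hM : M = !![1 - Polynomial.X, Polynomial.X; 1, 0]) (a : ℕ) :
    ((M ^ a) 0 0).degree = (a : ℕ) := by
  have key : (M ^ a) 0 0 + (M ^ a) 0 1 = 1 ∧ ((M ^ a) 0 0).degree = (a : ℕ) := by
    induction a with
    | zero => simp
    | succ k ih =>
      obtain ⟨h1, h2⟩ := ih
      have e0 : (M ^ (k+1)) 0 0 = 1 - (M ^ k) 0 0 * Polynomial.X := by
        rw [pow_succ, Matrix.mul_apply, Fin.sum_univ_two]
        have a0 : M 0 0 = 1 - Polynomial.X := by simp [hM]
        have a1 : M 1 0 = 1 := by simp [hM]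
        rw [a0, a1]
        linear_combination h1
      have e1 : (M ^ (k+1)) 0 1 = (M ^ k) 0 0 * Polynomial.X := by
        rw [pow_succ, Matrix.mul_apply, Fin.sum_univ_two]
        have a0 : M 0 1 = Polynomial.X := by simp [hM]
        have a1 : M 1 1 = 0 := by simp [hM]
        rw [a0, a1]
        ring
      refine ⟨by rw [e0, e1]; ring, ?_⟩
      have hd : ((M ^ k) 0 0 * Polynomial.X).degree = ((k + 1 : ℕ) : WithBot ℕ) := by
        rw [Polynomial.degree_mul, h2, Polynomial.degree_X]; norm_cast
      rw [e0, Polynomial.degree_sub_eq_right_of_degree_lt, hd]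
      rw [hd, Polynomial.degree_one]
      exact_mod_cast Nat.succ_pos k
  exact key.2
end

section
/- Let p be an odd prime and n ≥ 2 an integer. For a positive integer r define λ_p(r) := 0 if r is odd, and λ_p(r) := p^{v_p(r)} if r is even. For μ ∈ ℤ_{≥0} define d(μ) := 1/2 if μ = 0, d(μ) := (1/(2 p^a))·(1 - 1/p) if μ = p^a for some a ∈ ℤ_{≥0}, and d(μ) := 0 otherwise. Then for every tuple λ = (λ_1, …, λ_{n-1}) of non-negative integers, the limit as N → ∞ of the ratio #{k = (k_1, …, k_{n-1}) ∈ ℤ_{≥1}^{n-1} : k_1 + ⋯ + k_{n-1} ≤ N and λ_p(k_i) = λ_i for all i} / #{k ∈ ℤ_{≥0}^{n-1} : k_1 + ⋯ + k_{n-1} ≤ N} exists and equals the product ∏_{i=1}^{n-1} d(λ_i). -/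
open scoped Classical

/-- The λ-invariant of the completed Alexander polynomial of the torus link
closing `σ₁^r`: `0` if `r` is odd, and `p ^ v_p(r)` if `r` is even. -/
def lamTorus (p r : ℕ) : ℕ :=
  if Odd r then 0 else p ^ padicValNat p r

/-- The natural density of `{r ≥ 1 : lamTorus p r = μ}`. -/
noncomputable def densTorus (p μ : ℕ) : ℝ :=
  if μ = 0 then 1 / 2
  else if ∃ a : ℕ, μ = p ^ a then (1 / (2 * (μ : ℝ))) * (1 - 1 / (p : ℝ))
  else 0


noncomputable def cnt (m : ℕ) (P : Fin m → ℕ → Prop) (N : ℕ) : ℕ :=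
  ((Fintype.piFinset fun _ : Fin m => Finset.range (N + 1)).filter
    fun k => (∑ i, k i) ≤ N ∧ ∀ i, P i (k i)).card

lemma mem_aux {m : ℕ} (P : Fin m → ℕ → Prop) (N : ℕ) (k : Fin m → ℕ) :
    k ∈ ((Fintype.piFinset fun _ : Fin m => Finset.range (N + 1)).filter
    fun k => (∑ i, k i) ≤ N ∧ ∀ i, P i (k i)) ↔ (∑ i, k i) ≤ N ∧ ∀ i, P i (k i) := by
  simp only [Finset.mem_filter, Fintype.mem_piFinset, Finset.mem_range, and_iff_right_iff_imp]
  rintro ⟨h, -⟩ i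
  have := Finset.single_le_sum (f := k) (fun _ _ => Nat.zero_le _) (Finset.mem_univ i)
  omega

lemma cnt_zero (P : Fin 0 → ℕ → Prop) (N : ℕ) : cnt 0 P N = 1 := by
  simp [cnt]

lemma cnt_succ (m : ℕ) (P : Fin (m + 1) → ℕ → Prop) (N : ℕ) :
    (cnt (m + 1) P N : ℝ) = ∑ k ∈ Finset.range (N + 1),
      (if P 0 k then (1 : ℝ) else 0) * cnt m (fun i => P i.succ) (N - k) := by
  have : cnt (m + 1) P N = ∑ k ∈ (Finset.range (N + 1)).filter (P 0),
      cnt m (fun i => P i.succ) (N - k) := by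
    unfold cnt
    rw [← Finset.card_sigma]
    refine Finset.card_nbij' (fun k => ⟨k 0, fun i => k i.succ⟩)
      (fun s => Fin.cons s.1 s.2) ?_ ?_ ?_ ?_
    · intro k hk
      rw [Finset.mem_coe, mem_aux, Fin.sum_univ_succ] at hk
      rw [Finset.mem_coe, Finset.mem_sigma, mem_aux, Finset.mem_filter, Finset.mem_range]
      refine ⟨⟨by dsimp only; omega, hk.2 0⟩, by dsimp only; omega, fun i => hk.2 _⟩
    · rintro ⟨a, k⟩ hk
      rw [Finset.mem_coe, Finset.mem_sigma, mem_aux, Finset.mem_filter, Finset.mem_range] at hk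
      rw [Finset.mem_coe, mem_aux, Fin.sum_univ_succ]
      obtain ⟨⟨h1, h2⟩, h3, h4⟩ := hk
      dsimp only at *
      refine ⟨by simp only [Fin.cons_zero, Fin.cons_succ]; omega, fun i => ?_⟩
      refine Fin.cases ?_ (fun j => ?_) i
      · simpa using h2
      · simpa using h4 j
    · intro k _
      exact Fin.cons_self_tail k
    · rintro ⟨a, k⟩ _
      simp
  rw [this, Finset.sum_filter]
  push_cast
  refine Finset.sum_congr rfl fun k _ => ?_
  split_ifs <;> simp

lemma abel_bound (e : ℕ → ℝ) (C : ℝ)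
    (he : ∀ N, |∑ k ∈ Finset.range (N + 1), e k| ≤ C) (N : ℕ) :
    ∀ g : ℕ → ℝ, Monotone g → 0 ≤ g 0 →
      |∑ k ∈ Finset.range (N + 1), e k * g (N - k)| ≤ C * g N := by
  induction N with
  | zero =>
    intro g _ h0
    have := he 0
    simp only [zero_add, Finset.sum_range_one] at this ⊢
    rw [abs_mul, abs_of_nonneg h0]
    gcongr
  | succ N ih =>
    intro g hg h0
    have h1 := ih (fun x => g (x + 1) - g 0) (fun a b h => by
      have := hg (Nat.succ_le_succ h)
      simpa using this) (by simpa using hg (Nat.zero_le 1))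
    have h2 : ∑ k ∈ Finset.range (N + 1 + 1), e k * g (N + 1 - k)
        = (∑ k ∈ Finset.range (N + 1), e k * (g (N - k + 1) - g 0))
          + (∑ k ∈ Finset.range (N + 1 + 1), e k) * g 0 := by
      rw [Finset.sum_range_succ, Finset.sum_range_succ e, add_mul, Finset.sum_mul, ← add_assoc,
        ← Finset.sum_add_distrib]
      congr 1
      · refine Finset.sum_congr rfl fun k hk => ?_
        rw [Finset.mem_range] at hk
        rw [show N + 1 - k = N - k + 1 by omega]
        ring
      · simp
    rw [h2]
    refine (abs_add_le _ _).trans ?_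
    rw [abs_mul, abs_of_nonneg h0]
    have := mul_le_mul_of_nonneg_right (he (N + 1)) h0
    nlinarith

lemma cnt_mono (m : ℕ) (P : Fin m → ℕ → Prop) : Monotone (fun N => (cnt m P N : ℝ)) := by
  intro a b h
  simp only [Nat.cast_le]
  refine Finset.card_le_card fun k hk => ?_
  rw [mem_aux] at hk ⊢
  exact ⟨hk.1.trans h, hk.2⟩

lemma cnt_le (m : ℕ) (P : Fin m → ℕ → Prop) (N : ℕ) : (cnt m P N : ℝ) ≤ ((N : ℝ) + 1) ^ m := by
  have : cnt m P N ≤ (N + 1) ^ m := by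
    refine (Finset.card_filter_le _ _).trans ?_
    simp
  exact_mod_cast this

lemma cnt_ge (m : ℕ) (hm : 0 < m) (N : ℕ) :
    (((N : ℝ) + 1) / m) ^ m ≤ cnt m (fun _ _ => True) N := by
  have h : (N / m + 1) ^ m ≤ cnt m (fun _ _ => True) N := by
    have : (Fintype.piFinset fun _ : Fin m => Finset.range (N / m + 1)).card = (N / m + 1) ^ m := by
      simp
    rw [← this]
    refine Finset.card_le_card fun k hk => ?_
    simp only [Fintype.mem_piFinset, Finset.mem_range] at hk
    refine (mem_aux (fun _ _ => True) N k).2 ⟨?_, fun _ => trivial⟩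
    calc ∑ i, k i ≤ ∑ _i : Fin m, N / m := Finset.sum_le_sum fun i _ => by have := hk i; omega
      _ = m * (N / m) := by simp
      _ ≤ N := Nat.mul_div_le N m
  have h' : (((N / m : ℕ) : ℝ) + 1) ^ m ≤ cnt m (fun _ _ => True) N := by exact_mod_cast h
  refine le_trans ?_ h'
  gcongr
  rw [div_le_iff₀ (by positivity)]
  have : N + 1 ≤ (N / m + 1) * m := by
    have := Nat.lt_div_mul_add (a := N) hm
    nlinarith
  exact_mod_cast this

lemma main_bound (C : ℝ) (m : ℕ) : ∀ (P : Fin m → ℕ → Prop) (d : Fin m → ℝ),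
    (∀ i N, |∑ k ∈ Finset.range (N + 1), ((if P i k then (1 : ℝ) else 0) - d i)| ≤ C) →
    ∃ K : ℝ, 0 ≤ K ∧ ∀ N : ℕ, |(cnt m P N : ℝ) - (∏ i, d i) * cnt m (fun _ _ => True) N|
      ≤ K * m * ((N : ℝ) + 1) ^ (m - 1) := by
  induction m with
  | zero =>
    intro P d _
    exact ⟨0, le_rfl, fun N => by simp [cnt_zero]⟩
  | succ m ih =>
    intro P d h
    obtain ⟨K, hK, hb⟩ := ih (fun i => P i.succ) (fun i => d i.succ) (fun i => h i.succ)
    have hC : 0 ≤ C := (abs_nonneg _).trans (h 0 0)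
    set D := ∏ i : Fin m, d i.succ with hD
    refine ⟨K * m + |D| * C, by positivity, fun N => ?_⟩
    have e1 : (cnt (m + 1) P N : ℝ) - (∏ i, d i) * cnt (m + 1) (fun _ _ => True) N
        = (∑ k ∈ Finset.range (N + 1), (if P 0 k then (1 : ℝ) else 0) *
            (cnt m (fun i => P i.succ) (N - k) - D * cnt m (fun _ _ => True) (N - k)))
          + D * ∑ k ∈ Finset.range (N + 1), ((if P 0 k then (1 : ℝ) else 0) - d 0) *
            cnt m (fun _ _ => True) (N - k) := by
      rw [cnt_succ, cnt_succ, Fin.prod_univ_succ, ← hD, Finset.mul_sum, Finset.mul_sum,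
        ← Finset.sum_sub_distrib, ← Finset.sum_add_distrib]
      refine Finset.sum_congr rfl fun k _ => ?_
      simp only [if_true]
      ring
    have e2 : |∑ k ∈ Finset.range (N + 1), (if P 0 k then (1 : ℝ) else 0) *
            (cnt m (fun i => P i.succ) (N - k) - D * cnt m (fun _ _ => True) (N - k))|
          ≤ K * m * ((N : ℝ) + 1) ^ m := by
      have : ∀ k ∈ Finset.range (N + 1), |(if P 0 k then (1 : ℝ) else 0) *
            (cnt m (fun i => P i.succ) (N - k) - D * cnt m (fun _ _ => True) (N - k))|
            ≤ K * m * ((N : ℝ) + 1) ^ (m - 1) := by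
        intro k _
        rw [abs_mul]
        have h1 : |(if P 0 k then (1 : ℝ) else 0)| ≤ 1 := by split_ifs <;> simp
        have h2 := hb (N - k)
        have h3 : K * m * (((N - k : ℕ) : ℝ) + 1) ^ (m - 1) ≤ K * m * ((N : ℝ) + 1) ^ (m - 1) := by
          gcongr
          omega
        calc _ ≤ 1 * |_| := mul_le_mul_of_nonneg_right h1 (abs_nonneg _)
          _ ≤ _ := by rw [one_mul]; exact h2.trans h3
      refine (Finset.abs_sum_le_sum_abs _ _).trans ((Finset.sum_le_sum this).trans ?_)
      rw [Finset.sum_const, Finset.card_range, nsmul_eq_mul]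
      rcases m with _ | m
      · simp
      · push_cast
        rw [pow_succ]
        apply le_of_eq
        ring
    have e3 := abel_bound _ C (h 0) N (fun x => (cnt m (fun _ _ => True) x : ℝ))
      (cnt_mono m _) (by positivity)
    have e4 := cnt_le m (fun _ _ => True) N
    rw [e1]
    refine (abs_add_le _ _).trans ?_
    rw [abs_mul, Nat.add_sub_cancel]
    have e5 := mul_le_mul_of_nonneg_left (e3.trans (mul_le_mul_of_nonneg_left e4 hC)) (abs_nonneg D)
    have e6 : 0 ≤ (K * m + |D| * C) * m * ((N : ℝ) + 1) ^ m := by positivity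
    push_cast
    nlinarith

lemma main_lim (C : ℝ) (m : ℕ) (hm : 0 < m) (P : Fin m → ℕ → Prop) (d : Fin m → ℝ)
    (h : ∀ i N, |∑ k ∈ Finset.range (N + 1), ((if P i k then (1 : ℝ) else 0) - d i)| ≤ C) :
    Filter.Tendsto (fun N => (cnt m P N : ℝ) / cnt m (fun _ _ => True) N) Filter.atTop
      (nhds (∏ i, d i)) := by
  obtain ⟨K, hK, hb⟩ := main_bound C m P d h
  rw [tendsto_iff_norm_sub_tendsto_zero]
  have hlim : Filter.Tendsto (fun N : ℕ => (K * m * m ^ m) * (1 / ((N : ℝ) + 1))) Filter.atTop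
      (nhds 0) := by
    simpa using (tendsto_one_div_add_atTop_nhds_zero_nat (𝕜 := ℝ)).const_mul (K * m * m ^ m)
  refine squeeze_zero (fun _ => norm_nonneg _) (fun N => ?_) hlim
  have hg := cnt_ge m hm N
  have hm' : (0 : ℝ) < m := by exact_mod_cast hm
  have hpos : (0 : ℝ) < (((N : ℝ) + 1) / m) ^ m := by positivity
  have hT := hpos.trans_le hg
  rw [Real.norm_eq_abs, div_sub' hT.ne', abs_div, abs_of_pos hT, mul_comm (cnt m (fun _ _ => True) N : ℝ)]
  calc _ ≤ K * m * ((N : ℝ) + 1) ^ (m - 1) / (((N : ℝ) + 1) / m) ^ m := by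
        gcongr
        exact hb N
    _ = _ := by
        obtain ⟨q, rfl⟩ : ∃ q, m = q + 1 := ⟨m - 1, by omega⟩
        rw [Nat.add_sub_cancel, div_pow, pow_succ ((N : ℝ) + 1)]
        field_simp

lemma mult_count (q : ℕ) (hq : 0 < q) (N : ℕ) :
    |(∑ k ∈ Finset.range (N + 1), if (1 ≤ k ∧ q ∣ k) then (1 : ℝ) else 0) - ((N : ℝ) + 1) / q| ≤ 1 := by
  have h : (∑ k ∈ Finset.range (N + 1), if (1 ≤ k ∧ q ∣ k) then (1 : ℝ) else 0) = ((N / q : ℕ) : ℝ) := by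
    rw [← Finset.sum_filter, Finset.sum_const, nsmul_eq_mul, mul_one, ← Nat.Ioc_filter_dvd_card_eq_div]
    congr 2
    ext k
    simp only [Finset.mem_filter, Finset.mem_range, Finset.mem_Ioc]
    omega
  rw [h]
  have hq' : (0 : ℝ) < q := by exact_mod_cast hq
  have h1 : ((N / q : ℕ) : ℝ) * q ≤ N := by exact_mod_cast Nat.div_mul_le_self N q
  have h2 : (N : ℝ) + 1 ≤ (((N / q : ℕ) : ℝ) + 1) * q := by
    have : N + 1 ≤ (N / q + 1) * q := by
      have := Nat.lt_div_mul_add (a := N) hq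
      nlinarith
    exact_mod_cast this
  have h3 : (1 : ℝ) ≤ q := by exact_mod_cast hq
  have h4 : ((N : ℝ) + 1) / q ≤ ((N / q : ℕ) : ℝ) + 1 := by rwa [div_le_iff₀ hq']
  have h5 : ((N / q : ℕ) : ℝ) ≤ ((N : ℝ) + 1) / q := by rw [le_div_iff₀ hq']; linarith
  rw [abs_le]
  constructor <;> linarith

lemma two_count (q r : ℕ) (hq : 0 < q) (hr : 0 < r) (P : ℕ → Prop) [DecidablePred P] (d : ℝ)
    (hd : d = 1 / q - 1 / r)
    (hP : ∀ k, (if P k then (1 : ℝ) else 0) =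
      (if (1 ≤ k ∧ q ∣ k) then (1 : ℝ) else 0) - (if (1 ≤ k ∧ r ∣ k) then (1 : ℝ) else 0)) (N : ℕ) :
    |∑ k ∈ Finset.range (N + 1), ((if P k then (1 : ℝ) else 0) - d)| ≤ 2 := by
  have h1 := mult_count q hq N
  have h2 := mult_count r hr N
  simp only [hP, Finset.sum_sub_distrib]
  rw [Finset.sum_const, Finset.card_range, nsmul_eq_mul, hd]
  push_cast
  rw [abs_le] at *
  have e : ((N : ℝ) + 1) * (1 / q - 1 / r) = ((N : ℝ) + 1) / q - ((N : ℝ) + 1) / r := by ring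
  constructor <;> linarith [h1.1, h1.2, h2.1, h2.2]

lemma lam_count (p : ℕ) (hp : p.Prime) (hpodd : Odd p) (μ N : ℕ) :
    |∑ k ∈ Finset.range (N + 1), ((if (1 ≤ k ∧ lamTorus p k = μ) then (1 : ℝ) else 0)
      - densTorus p μ)| ≤ 2 := by
  have := Fact.mk hp
  have hp0 : (p : ℝ) ≠ 0 := by exact_mod_cast hp.ne_zero
  by_cases h0 : μ = 0
  · subst h0
    refine two_count 1 2 one_pos two_pos (fun k => 1 ≤ k ∧ lamTorus p k = _) _ ?_ (fun k => ?_) N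
    · simp [densTorus]; norm_num
    have : lamTorus p k = 0 ↔ ¬ 2 ∣ k := by
      unfold lamTorus
      rw [← even_iff_two_dvd, Nat.not_even_iff_odd]
      split_ifs with h
      · simp [h]
      · simp [h, hp.ne_zero]
    simp only [this, one_dvd, and_true]
    by_cases h1 : 1 ≤ k <;> by_cases h2 : 2 ∣ k <;> simp [h1, h2]
  by_cases ha : ∃ a : ℕ, μ = p ^ a
  · have hd : densTorus p μ = (1 / (2 * (μ : ℝ))) * (1 - 1 / (p : ℝ)) := by
      rw [densTorus, if_neg h0, if_pos ha]
    rw [hd]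
    obtain ⟨a, rfl⟩ := ha
    have hc : ∀ b, Nat.Coprime 2 (p ^ b) := fun b =>
      Nat.Coprime.pow_right b (Nat.coprime_two_left.mpr hpodd)
    have hpp : ∀ b, 0 < 2 * p ^ b := fun b => Nat.mul_pos two_pos (pow_pos hp.pos _)
    refine two_count (2 * p ^ a) (2 * p ^ (a + 1)) (hpp _) (hpp _) (fun k => 1 ≤ k ∧ lamTorus p k = _) _
      ?_ (fun k => ?_) N
    · push_cast; rw [pow_succ]; field_simp
    by_cases h1 : 1 ≤ k
    swap
    · simp [h1]
    have hdv : ∀ b, 2 * p ^ b ∣ k ↔ 2 ∣ k ∧ b ≤ padicValNat p k := fun b => by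
      rw [← padicValNat_dvd_iff_le (by omega)]
      exact ⟨fun h => ⟨(Dvd.intro _ rfl).trans h, (Dvd.intro_left _ rfl).trans h⟩,
        fun h => (hc b).mul_dvd_of_dvd_of_dvd h.1 h.2⟩
    have : lamTorus p k = p ^ a ↔ 2 ∣ k ∧ padicValNat p k = a := by
      unfold lamTorus
      rw [← even_iff_two_dvd, ← Nat.not_odd_iff_even]
      split_ifs with h
      · simp only [h, not_true, false_and, iff_false]
        exact (pow_pos hp.pos a).ne
      · simp only [h, not_false_iff, true_and]
        exact (Nat.pow_right_injective hp.two_le).eq_iff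
    simp only [this, hdv, h1, true_and]
    by_cases h2 : 2 ∣ k
    swap
    · simp [h2]
    simp only [h2, true_and]
    rcases lt_trichotomy (padicValNat p k) a with h | h | h
    · rw [if_neg (by omega), if_neg (by omega), if_neg (by omega)]; simp
    · rw [if_pos (by omega), if_pos (by omega), if_neg (by omega)]; simp
    · rw [if_neg (by omega), if_pos (by omega), if_pos (by omega)]; simp
  · have hd : densTorus p μ = 0 := by
      rw [densTorus, if_neg h0, if_neg ha]
    refine two_count 1 1 one_pos one_pos (fun k => 1 ≤ k ∧ lamTorus p k = _) _ ?_ (fun k => ?_) N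
    · rw [hd]; simp
    rw [if_neg, sub_self]
    rintro ⟨-, h⟩
    unfold lamTorus at h
    split_ifs at h
    · exact h0 h.symm
    · exact ha ⟨_, h.symm⟩

theorem stmt11 (p : ℕ) (hp : p.Prime) (hpodd : Odd p) (n : ℕ) (hn : 2 ≤ n)
    (lam : Fin (n - 1) → ℕ) :
    Filter.Tendsto
      (fun N : ℕ =>
        (((Fintype.piFinset fun _ : Fin (n - 1) => Finset.range (N + 1)).filter
            fun k => (∑ i, k i) ≤ N ∧ ∀ i, 1 ≤ k i ∧ lamTorus p (k i) = lam i).card : ℝ) /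
        (((Fintype.piFinset fun _ : Fin (n - 1) => Finset.range (N + 1)).filter
            fun k => (∑ i, k i) ≤ N).card : ℝ))
      Filter.atTop
      (nhds (∏ i : Fin (n - 1), densTorus p (lam i))) := by
  have := main_lim 2 (n - 1) (by omega) (fun i k => 1 ≤ k ∧ lamTorus p k = lam i)
    (fun i => densTorus p (lam i)) (fun i N => by
      convert lam_count p hp hpodd (lam i) N using 5)
  refine this.congr fun N => ?_
  unfold cnt
  congr 2
  · congr!
  · congr 2
    ext k
    simp
end
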